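/- Let $N \ge 1$, let $B \subset \mathbb{R}^N$ be a bounded open set, let $A_0 \in \mathbb{R}^N$, and let $A_n : B \to \mathbb{R}^N$ be measurable maps converging uniformly on $B$ to the constant map $A_0$. Let $v_n, W : \mathbb{R}^N \to \mathbb{C}$ be continuously differentiable with $\sup_n \int_B |\nabla v_n|^2\,dy < \infty$, suppose $\int_B |v_n - W|^2\,dy \to 0$, and suppose that for every continuous compactly supported $\Phi : B \to \mathbb{C}^N$ one has $\int_B \langle \nabla v_n, \Phi \rangle\,dy \to \int_B \langle \nabla W, \Phi \rangle\,dy$. Then $\liminf_{n \to \infty} \int_B \big| -i\nabla v_n(y) - A_n(y) v_n(y) \big|^2\,dy \ge \int_B \big| -i\nabla W(y) - A_0 W(y) \big|^2\,dy$. -/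

import Mathlib

open MeasureTheory Filter Complex

noncomputable section

/-- partial derivative of a complex-valued `u` in the `j`-th coordinate direction -/
def pd {N : ℕ} (u : EuclideanSpace ℝ (Fin N) → ℂ) (j : Fin N)
    (y : EuclideanSpace ℝ (Fin N)) : ℂ :=
  fderiv ℝ u y (EuclideanSpace.single j (1 : ℝ))

/-- `|∇u(y)|² = ∑ j |∂ⱼu(y)|²` -/
def gradSq {N : ℕ} (u : EuclideanSpace ℝ (Fin N) → ℂ)
    (y : EuclideanSpace ℝ (Fin N)) : ℝ :=
  ∑ j, ‖pd u j y‖ ^ 2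

/-- `|-i∇u(y) - B(y)u(y)|² = ∑ j |-i∂ⱼu(y) - Bⱼ(y)u(y)|²` -/
def magSq {N : ℕ} (B : EuclideanSpace ℝ (Fin N) → EuclideanSpace ℝ (Fin N))
    (u : EuclideanSpace ℝ (Fin N) → ℂ) (y : EuclideanSpace ℝ (Fin N)) : ℝ :=
  ∑ j, ‖(-Complex.I) * pd u j y - (B y j : ℂ) * u y‖ ^ 2

/-- the pairing `⟨∇v, Φ⟩(y) = Re ∑ j ∂ⱼv(y) conj(Φⱼ(y))` -/
def gradPair {N : ℕ} (v : EuclideanSpace ℝ (Fin N) → ℂ)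
    (Φ : EuclideanSpace ℝ (Fin N) → Fin N → ℂ) (y : EuclideanSpace ℝ (Fin N)) : ℝ :=
  (∑ j, pd v j y * (starRingEnd ℂ) (Φ y j)).re

/-- The partial derivatives of a `C¹` function are continuous. -/
theorem continuous_pd {N : ℕ} {u : EuclideanSpace ℝ (Fin N) → ℂ} (hu : ContDiff ℝ 1 u)
    (j : Fin N) : Continuous (pd u j) :=
  (hu.continuous_fderiv one_ne_zero).clm_apply continuous_const

/-- The components of the magnetic gradient `-i∇u - A₀u` for a constant potential. -/
def magGrad {N : ℕ} (A₀ : EuclideanSpace ℝ (Fin N)) (u : EuclideanSpace ℝ (Fin N) → ℂ)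
    (y : EuclideanSpace ℝ (Fin N)) (j : Fin N) : ℂ :=
  (-Complex.I) * pd u j y - (A₀ j : ℂ) * u y

theorem continuous_magGrad {N : ℕ} (A₀ : EuclideanSpace ℝ (Fin N))
    {u : EuclideanSpace ℝ (Fin N) → ℂ} (hu : ContDiff ℝ 1 u) : Continuous (magGrad A₀ u) := by
  have h1 := fun j => continuous_pd hu j
  have h2 := hu.continuous
  unfold magGrad
  fun_prop

/-- Continuous functions are integrable on bounded sets. -/
theorem Continuous.integrableOn_of_isBounded {N : ℕ} {F : Type*} [NormedAddCommGroup F]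
    {f : EuclideanSpace ℝ (Fin N) → F} (hf : Continuous f)
    {B : Set (EuclideanSpace ℝ (Fin N))} (hB : Bornology.IsBounded B) : IntegrableOn f B :=
  (hf.continuousOn.integrableOn_compact hB.isCompact_closure).mono_set subset_closure

/-- On a finite measure space, convergence to zero in `L²` implies convergence in `L¹`. -/
theorem tendsto_integral_zero_of_sq {α : Type*} [MeasurableSpace α] {μ : Measure α}
    [IsFiniteMeasure μ] {f : ℕ → α → ℝ} (h0 : ∀ n x, 0 ≤ f n x) (h1 : ∀ n, Integrable (f n) μ)
    (h2 : ∀ n, Integrable (fun x => f n x ^ 2) μ)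
    (h : Tendsto (fun n => ∫ x, f n x ^ 2 ∂μ) atTop (nhds 0)) :
    Tendsto (fun n => ∫ x, f n x ∂μ) atTop (nhds 0) := by
  set V := μ.real Set.univ
  have key : ∀ n, (∫ x, f n x ∂μ) ≤ √(V * ∫ x, f n x ^ 2 ∂μ) := by
    intro n
    set a := ∫ x, f n x ∂μ
    set b := ∫ x, f n x ^ 2 ∂μ
    have hq : ∀ t : ℝ, 0 ≤ V * (t * t) + (-2 * a) * t + b := by
      intro t
      have : ∫ x, (t - f n x) ^ 2 ∂μ = V * (t * t) + (-2 * a) * t + b := by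
        have e : ∀ x, (t - f n x) ^ 2 = t * t - (2 * t) * f n x + f n x ^ 2 := fun x => by ring
        have hsub : Integrable (fun x => t * t - (2 * t) * f n x) μ :=
          (integrable_const _).sub ((h1 n).const_mul _)
        simp_rw [e]
        rw [integral_add hsub (h2 n),
          integral_sub (integrable_const _) ((h1 n).const_mul _), integral_const,
          integral_const_mul, smul_eq_mul]
        ring
      rw [← this]
      exact integral_nonneg fun x => sq_nonneg _
    have := discrim_le_zero hq
    unfold discrim at this
    apply Real.le_sqrt_of_sq_le
    linarith
  refine squeeze_zero (fun n => integral_nonneg (h0 n)) key ?_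
  have := (h.const_mul V).sqrt
  simpa using this

/-- A bounded open set, not the whole space, carries continuous cutoffs increasing to `1`. -/
theorem exists_cutoff_tendsto_one {N : ℕ} (hN : 1 ≤ N) {B : Set (EuclideanSpace ℝ (Fin N))}
    (hBopen : IsOpen B) (hBbdd : Bornology.IsBounded B) :
    ∃ φ : ℕ → EuclideanSpace ℝ (Fin N) → ℝ, (∀ k, Continuous (φ k)) ∧
      (∀ k y, 0 ≤ φ k y) ∧ (∀ k y, φ k y ≤ 1) ∧
      (∀ k, HasCompactSupport (φ k)) ∧ (∀ k, tsupport (φ k) ⊆ B) ∧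
      ∀ y ∈ B, Tendsto (fun k => φ k y) atTop (nhds 1) := by
  have : Nonempty (Fin N) := ⟨⟨0, hN⟩⟩
  have hne : Bᶜ.Nonempty := by
    rw [Set.nonempty_compl]
    rintro rfl
    exact NormedSpace.unbounded_univ ℝ _ hBbdd
  have hts : ∀ k : ℕ, tsupport (fun y => min 1 (max 0 ((k : ℝ) * Metric.infDist y Bᶜ - 1))) ⊆ B := by
    intro k
    have hcl : IsClosed {y | 1 ≤ (k : ℝ) * Metric.infDist y Bᶜ} :=
      isClosed_le continuous_const (continuous_const.mul (Metric.continuous_infDist_pt _))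
    refine (closure_minimal ?_ hcl).trans ?_
    · intro y hy
      by_contra hlt
      simp only [Set.mem_ofPred_eq, not_le] at hlt
      apply hy
      simp only
      rw [max_eq_left (by linarith), min_eq_right zero_le_one]
    · intro y hy
      by_contra hyB
      have : Metric.infDist y Bᶜ = 0 := Metric.infDist_zero_of_mem hyB
      simp only [Set.mem_ofPred_eq, this, mul_zero] at hy
      linarith
  refine ⟨fun k y => min 1 (max 0 ((k : ℝ) * Metric.infDist y Bᶜ - 1)), ?_, ?_, ?_, ?_, hts, ?_⟩
  · intro k
    have := Metric.continuous_infDist_pt Bᶜ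
    fun_prop
  · intro k y
    exact le_min zero_le_one (le_max_left _ _)
  · intro k y
    exact min_le_left _ _
  · intro k
    exact Metric.isCompact_of_isClosed_isBounded (isClosed_tsupport _) (hBbdd.subset (hts k))
  · intro y hy
    have hpos : 0 < Metric.infDist y Bᶜ :=
      (hBopen.isClosed_compl.notMem_iff_infDist_pos hne).1 (by simpa using hy)
    refine tendsto_const_nhds.congr' ?_
    filter_upwards [(tendsto_natCast_atTop_atTop.atTop_mul_const hpos).eventually_ge_atTop 2]
      with k hk
    rw [max_eq_right (by linarith), min_eq_left (by linarith)]

/-- The lower-order terms `Aₙvₙ` converge weakly when tested against bounded fields. -/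
theorem tendsto_integral_potential_pairing {N : ℕ} {B : Set (EuclideanSpace ℝ (Fin N))}
    (hBopen : IsOpen B) (hBbdd : Bornology.IsBounded B)
    {A₀ : EuclideanSpace ℝ (Fin N)}
    {A : ℕ → EuclideanSpace ℝ (Fin N) → EuclideanSpace ℝ (Fin N)}
    (hAunif : TendstoUniformlyOn (fun n y => A n y) (fun _ => A₀) atTop B)
    {v : ℕ → EuclideanSpace ℝ (Fin N) → ℂ} {W : EuclideanSpace ℝ (Fin N) → ℂ}
    (hv : ∀ n, Continuous (v n)) (hW : Continuous W)
    (hL1 : Tendsto (fun n => ∫ y in B, ‖v n y - W y‖) atTop (nhds 0))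
    {Ψ : EuclideanSpace ℝ (Fin N) → Fin N → ℂ} (hΨ : Continuous Ψ)
    (hΨs : HasCompactSupport Ψ)
    (hint : ∀ᶠ n in atTop, IntegrableOn
      (fun y => (∑ j, ((A n y j : ℂ) * v n y) * (starRingEnd ℂ) (Ψ y j)).re) B) :
    Tendsto (fun n => ∫ y in B, (∑ j, ((A n y j : ℂ) * v n y) * (starRingEnd ℂ) (Ψ y j)).re)
      atTop (nhds (∫ y in B, (∑ j, ((A₀ j : ℂ) * W y) * (starRingEnd ℂ) (Ψ y j)).re)) := by
  obtain ⟨C, hC⟩ := hΨs.exists_bound_of_continuous hΨ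
  have hC0 : 0 ≤ C := (norm_nonneg _).trans (hC 0)
  have hI0 : IntegrableOn (fun y => (∑ j, ((A₀ j : ℂ) * W y) * (starRingEnd ℂ) (Ψ y j)).re) B := by
    apply Continuous.integrableOn_of_isBounded _ hBbdd
    fun_prop
  set K : ℝ := N * C with hK
  have hK0 : 0 ≤ K := by positivity
  set w := ∫ y in B, ‖W y‖
  have hw0 : 0 ≤ w := integral_nonneg fun y => norm_nonneg _
  rw [Metric.tendsto_nhds]
  intro ε hε
  set δ : ℝ := min 1 (ε / (2 * (K * w + 1))) with hδ
  have hδ0 : 0 < δ := by positivity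
  have hA := Metric.tendstoUniformlyOn_iff.1 hAunif δ hδ0
  have hL := hL1.eventually_lt_const
    (show (0 : ℝ) < ε / (2 * (K * (‖A₀‖ + 1) + 1)) by positivity)
  filter_upwards [hint, hA, hL] with n hn hAn hLn
  rw [dist_eq_norm, ← integral_sub hn hI0]
  have hIv : IntegrableOn (fun y => ‖v n y - W y‖) B :=
    Continuous.integrableOn_of_isBounded (by have := hv n; fun_prop) hBbdd
  have hIW : IntegrableOn (fun y => ‖W y‖) B :=
    Continuous.integrableOn_of_isBounded (by fun_prop) hBbdd
  have hmaj : IntegrableOn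
      (fun y => K * (‖A₀‖ + 1) * ‖v n y - W y‖ + K * δ * ‖W y‖) B :=
    (hIv.const_mul _).add (hIW.const_mul _)
  have hle : ∀ y ∈ B, ‖(∑ j, ((A n y j : ℂ) * v n y) * (starRingEnd ℂ) (Ψ y j)).re -
      (∑ j, ((A₀ j : ℂ) * W y) * (starRingEnd ℂ) (Ψ y j)).re‖ ≤
      K * (‖A₀‖ + 1) * ‖v n y - W y‖ + K * δ * ‖W y‖ := by
    intro y hy
    have hd : ‖A n y - A₀‖ ≤ δ := by
      have := (hAn y hy).le
      rwa [dist_eq_norm, norm_sub_rev] at this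
    rw [← Complex.sub_re, ← Finset.sum_sub_distrib]
    refine (Complex.abs_re_le_norm _).trans ((norm_sum_le _ _).trans ?_)
    refine (Finset.sum_le_card_nsmul _ _
      (((‖A₀‖ + 1) * ‖v n y - W y‖ + δ * ‖W y‖) * C) fun j _ => ?_).trans ?_
    · rw [← sub_mul, norm_mul, RCLike.norm_conj]
      have h1 : ‖Ψ y j‖ ≤ C := (norm_le_pi_norm _ j).trans (hC y)
      have h2 : ‖(A n y j : ℂ) - (A₀ j : ℂ)‖ ≤ δ := by
        rw [← Complex.ofReal_sub, Complex.norm_real]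
        exact (PiLp.norm_apply_le (A n y - A₀) j).trans hd
      have h3 : ‖(A n y j : ℂ)‖ ≤ ‖A₀‖ + 1 := by
        rw [Complex.norm_real]
        have h4 := PiLp.norm_apply_le (A n y) j
        have h5 := norm_le_norm_add_norm_sub' (A n y) A₀
        have h6 : δ ≤ 1 := min_le_left _ _
        linarith
      refine mul_le_mul ?_ h1 (norm_nonneg _) (by positivity)
      have e : (A n y j : ℂ) * v n y - (A₀ j : ℂ) * W y =
          (A n y j : ℂ) * (v n y - W y) + ((A n y j : ℂ) - (A₀ j : ℂ)) * W y := by ring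
      rw [e]
      refine (norm_add_le _ _).trans ?_
      rw [norm_mul, norm_mul]
      gcongr
    · rw [Finset.card_univ, Fintype.card_fin, nsmul_eq_mul, hK]
      apply le_of_eq
      ring
  calc _ ≤ ∫ y in B, (K * (‖A₀‖ + 1) * ‖v n y - W y‖ + K * δ * ‖W y‖) :=
        norm_integral_le_of_norm_le hmaj
          ((ae_restrict_iff' hBopen.measurableSet).2 (Eventually.of_forall hle))
    _ = K * (‖A₀‖ + 1) * (∫ y in B, ‖v n y - W y‖) + K * w * δ := by
        rw [integral_add (hIv.const_mul _) (hIW.const_mul _), integral_const_mul,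
          integral_const_mul]
        ring
    _ < ε := by
        have hP : 0 ≤ K * (‖A₀‖ + 1) := by positivity
        have hQ : 0 ≤ K * w := by positivity
        have h1 : δ ≤ ε / (2 * (K * w + 1)) := min_le_right _ _
        rw [le_div_iff₀ (by positivity)] at h1
        rw [lt_div_iff₀ (by positivity)] at hLn
        have hl0 : 0 ≤ ∫ y in B, ‖v n y - W y‖ := integral_nonneg fun y => norm_nonneg _
        nlinarith

theorem stmt15 {N : ℕ} (hN : 1 ≤ N) (B : Set (EuclideanSpace ℝ (Fin N)))
    (hBopen : IsOpen B) (hBbdd : Bornology.IsBounded B)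
    (A₀ : EuclideanSpace ℝ (Fin N))
    (A : ℕ → EuclideanSpace ℝ (Fin N) → EuclideanSpace ℝ (Fin N))
    (hAmeas : ∀ n, Measurable fun y : B => A n (y : EuclideanSpace ℝ (Fin N)))
    (hAunif : TendstoUniformlyOn (fun n y => A n y) (fun _ => A₀) atTop B)
    (v : ℕ → EuclideanSpace ℝ (Fin N) → ℂ) (W : EuclideanSpace ℝ (Fin N) → ℂ)
    (hv : ∀ n, ContDiff ℝ 1 (v n)) (hW : ContDiff ℝ 1 W)
    (hbound : ∃ M : ℝ, ∀ n,
      IntegrableOn (fun y => gradSq (v n) y) B ∧ (∫ y in B, gradSq (v n) y) ≤ M)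
    (hL2 : Tendsto (fun n => ∫ y in B, ‖v n y - W y‖ ^ 2) atTop (nhds 0))
    (hweak : ∀ Φ : EuclideanSpace ℝ (Fin N) → Fin N → ℂ, Continuous Φ →
      HasCompactSupport Φ → tsupport Φ ⊆ B →
      Tendsto (fun n => ∫ y in B, gradPair (v n) Φ y) atTop
        (nhds (∫ y in B, gradPair W Φ y))) :
    (∫ y in B, magSq (fun _ => A₀) W y)
      ≤ Filter.liminf (fun n => ∫ y in B, magSq (A n) (v n) y) atTop := by
  obtain ⟨M, hM⟩ := hbound
  have hvc := fun n => (hv n).continuous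
  have hWc := hW.continuous
  have hpd := fun n j => continuous_pd (hv n) j
  have hG := continuous_magGrad A₀ hW
  have hBm := hBopen.measurableSet
  have hfin : IsFiniteMeasure (volume.restrict B) :=
    isFiniteMeasure_restrict.2 hBbdd.measure_lt_top.ne
  have hcont : ∀ {f : EuclideanSpace ℝ (Fin N) → ℝ}, Continuous f → IntegrableOn f B :=
    fun hf => hf.integrableOn_of_isBounded hBbdd
  have hL1 : Tendsto (fun n => ∫ y in B, ‖v n y - W y‖) atTop (nhds 0) :=
    tendsto_integral_zero_of_sq (fun n y => norm_nonneg _)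
      (fun n => hcont (by have := hvc n; fun_prop)) (fun n => hcont (by have := hvc n; fun_prop)) hL2
  set a : ℝ := ‖A₀‖ + 1 with ha
  have ha0 : 0 ≤ a := by positivity
  have hAbd : ∀ᶠ n in atTop, ∀ y ∈ B, ∀ j, ‖(A n y j : ℂ)‖ ≤ a := by
    filter_upwards [Metric.tendstoUniformlyOn_iff.1 hAunif 1 one_pos] with n hn y hy j
    rw [Complex.norm_real]
    have h4 := PiLp.norm_apply_le (A n y) j
    have h5 := norm_le_norm_add_norm_sub' (A n y) A₀
    have h6 := (hn y hy).le
    rw [dist_eq_norm, norm_sub_rev] at h6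
    linarith
  have hAm : ∀ n j, AEStronglyMeasurable (fun y => (A n y j : ℂ)) (volume.restrict B) := by
    intro n j
    have h1 : AEMeasurable (A n) (volume.restrict B) :=
      aemeasurable_restrict_of_measurable_subtype hBm (hAmeas n)
    have h2 : Measurable fun x : EuclideanSpace ℝ (Fin N) => (x j : ℂ) :=
      Continuous.measurable (by fun_prop)
    exact (h2.comp_aemeasurable h1).aestronglyMeasurable
  have hFm : ∀ n j, AEStronglyMeasurable
      (fun y => (-Complex.I) * pd (v n) j y - (A n y j : ℂ) * v n y) (volume.restrict B) :=
    fun n j => (continuous_const.mul (hpd n j)).aestronglyMeasurable.sub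
      ((hAm n j).mul (hvc n).aestronglyMeasurable)
  have hmajor : ∀ᶠ n in atTop, ∀ y ∈ B, magSq (A n) (v n) y ≤
      2 * gradSq (v n) y + 4 * (N * a ^ 2) * (‖v n y - W y‖ ^ 2 + ‖W y‖ ^ 2) := by
    filter_upwards [hAbd] with n hn y hy
    have e : 2 * gradSq (v n) y + 4 * (N * a ^ 2) * (‖v n y - W y‖ ^ 2 + ‖W y‖ ^ 2) =
        ∑ j, (2 * ‖pd (v n) j y‖ ^ 2 + 4 * a ^ 2 * (‖v n y - W y‖ ^ 2 + ‖W y‖ ^ 2)) := by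
      rw [Finset.sum_add_distrib, ← Finset.mul_sum, Finset.sum_const, Finset.card_univ,
        Fintype.card_fin, nsmul_eq_mul, gradSq]
      ring
    rw [e, magSq]
    refine Finset.sum_le_sum fun j _ => ?_
    have h1 := norm_sub_le ((-Complex.I) * pd (v n) j y) ((A n y j : ℂ) * v n y)
    rw [norm_mul, norm_mul, norm_neg, Complex.norm_I, one_mul] at h1
    have h2 : ‖v n y‖ ≤ ‖v n y - W y‖ + ‖W y‖ := norm_le_norm_sub_add _ _
    have h3 : ‖(A n y j : ℂ)‖ * ‖v n y‖ ≤ a * (‖v n y - W y‖ + ‖W y‖) :=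
      mul_le_mul (hn y hy j) h2 (norm_nonneg _) ha0
    calc _ ≤ (‖pd (v n) j y‖ + a * (‖v n y - W y‖ + ‖W y‖)) ^ 2 :=
          pow_le_pow_left₀ (norm_nonneg _) (h1.trans (by linarith)) 2
      _ ≤ _ := by
          nlinarith [sq_nonneg (‖pd (v n) j y‖ - a * (‖v n y - W y‖ + ‖W y‖)),
            sq_nonneg (a * (‖v n y - W y‖ - ‖W y‖))]
  have hmajInt : ∀ n, IntegrableOn (fun y =>
      2 * gradSq (v n) y + 4 * (N * a ^ 2) * (‖v n y - W y‖ ^ 2 + ‖W y‖ ^ 2)) B := by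
    intro n
    refine ((hM n).1.const_mul 2).add (hcont ?_)
    have := hvc n
    fun_prop
  have hmag0 : ∀ n y, 0 ≤ magSq (A n) (v n) y :=
    fun n y => Finset.sum_nonneg fun j _ => sq_nonneg _
  have hmagInt : ∀ᶠ n in atTop, IntegrableOn (magSq (A n) (v n)) B := by
    filter_upwards [hmajor] with n hn
    refine Integrable.mono' (hmajInt n) ?_
      ((ae_restrict_iff' hBm).2 (Eventually.of_forall fun y hy => ?_))
    · exact Finset.aestronglyMeasurable_fun_sum _ fun j _ => (hFm n j).norm.pow 2
    · rw [Real.norm_of_nonneg (hmag0 n y)]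
      exact hn y hy
  have hcob : IsCoboundedUnder (· ≥ ·) atTop (fun n => ∫ y in B, magSq (A n) (v n) y) := by
    apply IsBoundedUnder.isCoboundedUnder_ge
    refine ⟨2 * M + 4 * (N * a ^ 2) * (1 + ∫ y in B, ‖W y‖ ^ 2), ?_⟩
    rw [eventually_map]
    filter_upwards [hmajor, hmagInt, hL2.eventually_le_const one_pos] with n hn hi hl
    have hI1 : IntegrableOn (fun y => ‖v n y - W y‖ ^ 2) B :=
      hcont (by have := hvc n; fun_prop)
    have hI2 : IntegrableOn (fun y => ‖W y‖ ^ 2) B := hcont (by fun_prop)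
    have hI12 : IntegrableOn
        (fun y => 4 * (N * a ^ 2) * (‖v n y - W y‖ ^ 2 + ‖W y‖ ^ 2)) B :=
      (hI1.add hI2).const_mul _
    refine (setIntegral_mono_on hi (hmajInt n) hBm hn).trans ?_
    rw [integral_add ((hM n).1.const_mul 2) hI12, integral_const_mul,
      integral_const_mul, integral_add hI1 hI2]
    have := (hM n).2
    gcongr
  obtain ⟨φ, hφc, hφ0, hφ1, hφs, hφB, hφt⟩ := exists_cutoff_tendsto_one hN hBopen hBbdd
  have hGsq : ∀ y, magSq (fun _ => A₀) W y = ∑ j, ‖magGrad A₀ W y j‖ ^ 2 := fun y => rfl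
  have hGc : Continuous (magSq (fun _ => A₀) W) := by
    have : ∀ j, Continuous fun y => magGrad A₀ W y j := fun j => (continuous_apply j).comp hG
    simp_rw [funext hGsq]
    fun_prop
  have hcut : ∀ k, (∫ y in B, (2 * φ k y - φ k y ^ 2) * magSq (fun _ => A₀) W y) ≤
      liminf (fun n => ∫ y in B, magSq (A n) (v n) y) atTop := by
    intro k
    set Ψ : EuclideanSpace ℝ (Fin N) → Fin N → ℂ := fun y => (φ k y : ℂ) • magGrad A₀ W y with hΨd
    have hφk := hφc k
    have hΨ : Continuous Ψ := by fun_prop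
    have hsuppΨ : Function.support Ψ ⊆ Function.support (φ k) := by
      intro y hy h0
      apply hy
      simp only [hΨd, h0, Complex.ofReal_zero, zero_smul]
    have hΨs : HasCompactSupport Ψ := (hφs k).mono hsuppΨ
    have hIΨsupp : Function.support (fun y => Complex.I • Ψ y) ⊆ Function.support (φ k) := by
      intro y hy
      apply hsuppΨ
      intro h0
      apply hy
      simp only [h0, smul_zero]
    have hw := hweak (fun y => Complex.I • Ψ y) (by fun_prop) ((hφs k).mono hIΨsupp)
      ((closure_mono hIΨsupp).trans (hφB k))
    have hgpInt : ∀ u : EuclideanSpace ℝ (Fin N) → ℂ, ContDiff ℝ 1 u →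
        IntegrableOn (gradPair u (fun y => Complex.I • Ψ y)) B := by
      intro u hu
      have := fun j => continuous_pd hu j
      apply hcont
      unfold gradPair
      fun_prop
    have hpotInt : ∀ᶠ n in atTop, IntegrableOn
        (fun y => (∑ j, ((A n y j : ℂ) * v n y) * (starRingEnd ℂ) (Ψ y j)).re) B := by
      filter_upwards [hAbd] with n hn
      have hb : IntegrableOn (fun y => ∑ j, (a * ‖v n y‖) * ‖Ψ y j‖) B :=
        hcont (by have := hvc n; fun_prop)
      refine Integrable.mono' hb ?_
        ((ae_restrict_iff' hBm).2 (Eventually.of_forall fun y hy => ?_))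
      · refine Complex.continuous_re.comp_aestronglyMeasurable
          (Finset.aestronglyMeasurable_fun_sum _ fun j _ =>
            ((hAm n j).mul (hvc n).aestronglyMeasurable).mul ?_)
        exact Continuous.aestronglyMeasurable (by fun_prop)
      · refine (Complex.abs_re_le_norm _).trans ((norm_sum_le _ _).trans
          (Finset.sum_le_sum fun j _ => ?_))
        rw [norm_mul, norm_mul, RCLike.norm_conj]
        gcongr
        exact hn y hy j
    have hp := tendsto_integral_potential_pairing hBopen hBbdd hAunif hvc hWc hL1 hΨ hΨs hpotInt
    have hI0 : IntegrableOn
        (fun y => (∑ j, ((A₀ j : ℂ) * W y) * (starRingEnd ℂ) (Ψ y j)).re) B :=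
      hcont (by fun_prop)
    have hsqInt : IntegrableOn (fun y => φ k y ^ 2 * magSq (fun _ => A₀) W y) B :=
      hcont (by fun_prop)
    have hΨsq : ∀ y, ∑ j, ‖Ψ y j‖ ^ 2 = φ k y ^ 2 * magSq (fun _ => A₀) W y := by
      intro y
      rw [hGsq, Finset.mul_sum]
      refine Finset.sum_congr rfl fun j _ => ?_
      simp only [hΨd, Pi.smul_apply, smul_eq_mul, norm_mul, Complex.norm_real, mul_pow,
        Real.norm_eq_abs, sq_abs]
    have hpair : ∀ (u : EuclideanSpace ℝ (Fin N) → ℂ) (b : EuclideanSpace ℝ (Fin N)) y,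
        gradPair u (fun y => Complex.I • Ψ y) y -
          (∑ j, ((b j : ℂ) * u y) * (starRingEnd ℂ) (Ψ y j)).re =
        (∑ j, ((-Complex.I) * pd u j y - (b j : ℂ) * u y) * (starRingEnd ℂ) (Ψ y j)).re := by
      intro u b y
      rw [gradPair, ← Complex.sub_re, ← Finset.sum_sub_distrib]
      congr 1
      refine Finset.sum_congr rfl fun j _ => ?_
      simp only [Pi.smul_apply, smul_eq_mul, map_mul, Complex.conj_I]
      ring
    have hlim := (((hw.sub hp).const_mul 2).sub_const
      (∫ y in B, φ k y ^ 2 * magSq (fun _ => A₀) W y))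
    have hval : 2 * ((∫ y in B, gradPair W (fun y => Complex.I • Ψ y) y) -
        ∫ y in B, (∑ j, ((A₀ j : ℂ) * W y) * (starRingEnd ℂ) (Ψ y j)).re) -
        (∫ y in B, φ k y ^ 2 * magSq (fun _ => A₀) W y) =
        ∫ y in B, (2 * φ k y - φ k y ^ 2) * magSq (fun _ => A₀) W y := by
      have hdiff : IntegrableOn (fun y => 2 * (gradPair W (fun y => Complex.I • Ψ y) y -
          (∑ j, ((A₀ j : ℂ) * W y) * (starRingEnd ℂ) (Ψ y j)).re)) B :=
        ((hgpInt W hW).sub hI0).const_mul 2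
      rw [← integral_sub (hgpInt W hW) hI0, ← integral_const_mul, ← integral_sub hdiff hsqInt]
      congr 1
      ext y
      have e : (∑ j, ((-Complex.I) * pd W j y - (A₀ j : ℂ) * W y) *
          (starRingEnd ℂ) (Ψ y j)).re = φ k y * magSq (fun _ => A₀) W y := by
        rw [hGsq, Finset.mul_sum, Complex.re_sum]
        refine Finset.sum_congr rfl fun j _ => ?_
        change (magGrad A₀ W y j * (starRingEnd ℂ) ((φ k y : ℂ) * magGrad A₀ W y j)).re = _
        rw [map_mul, Complex.conj_ofReal, mul_left_comm, Complex.mul_conj, Complex.re_ofReal_mul,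
          Complex.ofReal_re, Complex.normSq_eq_norm_sq]
      simp only [hpair W A₀ y]
      rw [e]
      ring
    rw [hval] at hlim
    rw [← hlim.liminf_eq]
    refine liminf_le_liminf ?_ hlim.isBoundedUnder_ge hcob
    filter_upwards [hpotInt, hmagInt] with n hn hi
    have hdiff : IntegrableOn (fun y => 2 * (gradPair (v n) (fun y => Complex.I • Ψ y) y -
        (∑ j, ((A n y j : ℂ) * v n y) * (starRingEnd ℂ) (Ψ y j)).re)) B :=
      ((hgpInt _ (hv n)).sub hn).const_mul 2
    rw [← integral_sub (hgpInt _ (hv n)) hn, ← integral_const_mul, ← integral_sub hdiff hsqInt]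
    refine integral_mono (hdiff.sub hsqInt) hi fun y => ?_
    simp only [hpair (v n) (A n y) y]
    rw [← hΨsq, Complex.re_sum, Finset.mul_sum, ← Finset.sum_sub_distrib, magSq]
    refine Finset.sum_le_sum fun j _ => ?_
    set z := (-Complex.I) * pd (v n) j y - (A n y j : ℂ) * v n y
    have h := Complex.normSq_sub z (Ψ y j)
    have h' := Complex.normSq_nonneg (z - Ψ y j)
    simp only [Complex.normSq_eq_norm_sq] at h h'
    linarith
  refine le_of_tendsto' (x := atTop) ?_ hcut
  refine tendsto_integral_of_dominated_convergence (magSq (fun _ => A₀) W)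
    (fun k => ?_) (hcont hGc) (fun k => Eventually.of_forall fun y => ?_)
    ((ae_restrict_iff' hBm).2 (Eventually.of_forall fun y hy => ?_))
  · have := hφc k
    exact Continuous.aestronglyMeasurable (by fun_prop)
  · have h0 := hφ0 k y
    have h1 := hφ1 k y
    have hg : 0 ≤ magSq (fun _ => A₀) W y := Finset.sum_nonneg fun j _ => sq_nonneg _
    rw [Real.norm_of_nonneg (mul_nonneg (by nlinarith) hg)]
    exact mul_le_of_le_one_left hg (by nlinarith)
  · have h := (((hφt y hy).const_mul 2).sub ((hφt y hy).pow 2)).mul_const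
      (magSq (fun _ => A₀) W y)
    norm_num at h
    exact h

end
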